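/- arXiv:0803.3480 — 2 statements merged into one kernel-verified Lean document; each statement's English description precedes it below -/
import Mathlib

section
/- Let Ω ⊆ H be an open set disjoint from the real axis. If f = u + ιv and g = u′ + ιv′ are hyperholomorphic on Ω, then their pointwise quaternionic product f·g (which is complex-like with decomposition (uu′ − vv′) + ι(uv′ + vu′), since at each point f(p) and g(p) lie in the commutative subalgebra ℝ + ℝ·ι(p)) is hyperholomorphic on Ω. -/
open Quaternion MeasureTheory

noncomputable section

/-- `r(p)` : distance from the real axis. -/
def rr (p : ℍ[ℝ]) : ℝ := Real.sqrt (p.imI ^ 2 + p.imJ ^ 2 + p.imK ^ 2)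

def qi : ℍ[ℝ] := ⟨0, 1, 0, 0⟩
def qj : ℍ[ℝ] := ⟨0, 0, 1, 0⟩
def qk : ℍ[ℝ] := ⟨0, 0, 0, 1⟩

/-- imaginary part of a quaternion -/
def qim (p : ℍ[ℝ]) : ℍ[ℝ] := ⟨0, p.imI, p.imJ, p.imK⟩

/-- `ι(p)` -/
def iota (p : ℍ[ℝ]) : ℍ[ℝ] := (rr p)⁻¹ • qim p

/-- left Fueter operator -/
def Dl (f : ℍ[ℝ] → ℍ[ℝ]) (p : ℍ[ℝ]) : ℍ[ℝ] :=
  fderiv ℝ f p 1 + qi * fderiv ℝ f p qi + qj * fderiv ℝ f p qj + qk * fderiv ℝ f p qk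

/-- right Fueter operator -/
def Dr (f : ℍ[ℝ] → ℍ[ℝ]) (p : ℍ[ℝ]) : ℍ[ℝ] :=
  fderiv ℝ f p 1 + fderiv ℝ f p qi * qi + fderiv ℝ f p qj * qj + fderiv ℝ f p qk * qk

/-- hyperholomorphic on `Ω` with decomposition `f = u + ι v` -/
def Hyperholo (Ω : Set ℍ[ℝ]) (f : ℍ[ℝ] → ℍ[ℝ]) (u v : ℍ[ℝ] → ℝ) : Prop :=
  (∀ p ∈ Ω, DifferentiableAt ℝ f p) ∧
  (∀ p ∈ Ω, f p = (u p : ℍ[ℝ]) + iota p * (v p : ℍ[ℝ])) ∧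
  (∀ p ∈ Ω, Dl f p = ((-2 * v p / rr p : ℝ) : ℍ[ℝ]))

/-- spherical parametrization of the imaginary unit sphere -/
def iotaSph (α β : ℝ) : ℍ[ℝ] :=
  ⟨0, Real.cos α * Real.sin β, Real.sin α * Real.sin β, Real.cos β⟩

/-- the point `t + r·ι(α,β)` -/
def pt (t r α β : ℝ) : ℍ[ℝ] := (t : ℍ[ℝ]) + (r : ℍ[ℝ]) * iotaSph α β

@[simp] lemma qim_re (p : ℍ[ℝ]) : (qim p).re = 0 := rfl
@[simp] lemma qim_imI (p : ℍ[ℝ]) : (qim p).imI = p.imI := rfl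
@[simp] lemma qim_imJ (p : ℍ[ℝ]) : (qim p).imJ = p.imJ := rfl
@[simp] lemma qim_imK (p : ℍ[ℝ]) : (qim p).imK = p.imK := rfl

@[simp] lemma qi_re : qi.re = 0 := rfl
@[simp] lemma qi_imI : qi.imI = 1 := rfl
@[simp] lemma qi_imJ : qi.imJ = 0 := rfl
@[simp] lemma qi_imK : qi.imK = 0 := rfl

@[simp] lemma qj_re : qj.re = 0 := rfl
@[simp] lemma qj_imI : qj.imI = 0 := rfl
@[simp] lemma qj_imJ : qj.imJ = 1 := rfl
@[simp] lemma qj_imK : qj.imK = 0 := rfl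

@[simp] lemma qk_re : qk.re = 0 := rfl
@[simp] lemma qk_imI : qk.imI = 0 := rfl
@[simp] lemma qk_imJ : qk.imJ = 0 := rfl
@[simp] lemma qk_imK : qk.imK = 1 := rfl

/-- `qim` as a continuous linear map. -/
def qimCLM : ℍ[ℝ] →L[ℝ] ℍ[ℝ] :=
  LinearMap.toContinuousLinearMap
    { toFun := qim
      map_add' := fun a b => by ext <;> simp
      map_smul' := fun c a => by ext <;> simp }

lemma qimCLM_apply (p : ℍ[ℝ]) : qimCLM p = qim p := rfl

lemma rr_ne_zero {p : ℍ[ℝ]} (hp : qim p ≠ 0) : rr p ≠ 0 := by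
  intro h
  apply hp
  rw [rr, Real.sqrt_eq_zero (by positivity)] at h
  ext
  · rfl
  all_goals
    simp only [qim, Quaternion.imI_zero, Quaternion.imJ_zero, Quaternion.imK_zero]
    nlinarith [sq_nonneg p.imI, sq_nonneg p.imJ, sq_nonneg p.imK]

lemma rr_sq (p : ℍ[ℝ]) : rr p ^ 2 = p.imI ^ 2 + p.imJ ^ 2 + p.imK ^ 2 :=
  Real.sq_sqrt (by positivity)

lemma qim_mul_self (p : ℍ[ℝ]) : qim p * qim p = ((-(rr p ^ 2) : ℝ) : ℍ[ℝ]) := by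
  ext <;> simp only [Quaternion.re_mul, Quaternion.imI_mul, Quaternion.imJ_mul,
    Quaternion.imK_mul, Quaternion.re_coe, Quaternion.imI_coe, Quaternion.imJ_coe,
    Quaternion.imK_coe, qim_re, qim_imI, qim_imJ, qim_imK, rr_sq] <;> ring

lemma iota_mul_self {p : ℍ[ℝ]} (hp : qim p ≠ 0) : iota p * iota p = -1 := by
  have h := rr_ne_zero hp
  rw [iota, smul_mul_smul_comm, qim_mul_self, Quaternion.smul_coe,
    show (rr p)⁻¹ * (rr p)⁻¹ * -(rr p ^ 2) = -1 by field_simp]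
  simp

/-- Differentiating the identity `q * g = g * q`, where `q` is the imaginary part. -/
lemma qim_mul_fderiv {Ω : Set ℍ[ℝ]} (hΩ : IsOpen Ω) {g : ℍ[ℝ] → ℍ[ℝ]}
    (hcomm : ∀ p ∈ Ω, qim p * g p = g p * qim p) {p : ℍ[ℝ]} (hp : p ∈ Ω)
    (hg : DifferentiableAt ℝ g p) (h : ℍ[ℝ]) :
    qim p * fderiv ℝ g p h = fderiv ℝ g p h * qim p + (g p * qim h - qim h * g p) := by
  have hq : HasFDerivAt qim qimCLM p := qimCLM.hasFDerivAt
  have h₁ := hq.mul' hg.hasFDerivAt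
  have h₂ := hg.hasFDerivAt.mul' hq
  have heq : (fun x => qim x * g x) =ᶠ[nhds p] fun x => g x * qim x :=
    Filter.eventually_of_mem (hΩ.mem_nhds hp) hcomm
  have h₃ := congrArg (fun L : ℍ[ℝ] →L[ℝ] ℍ[ℝ] => L h)
    (h₁.unique (h₂.congr_of_eventuallyEq heq))
  simp [qimCLM_apply] at h₃
  rw [eq_sub_of_add_eq h₃]
  abel

/-- Product rule for the left Fueter operator when the left factor is `a + b q` at the point,
`q` being the imaginary part, and the right factor commutes with `q` and has value `c + d q`. -/
lemma Dl_mul {Ω : Set ℍ[ℝ]} (hΩ : IsOpen Ω) {f g : ℍ[ℝ] → ℍ[ℝ]}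
    (hcomm : ∀ p ∈ Ω, qim p * g p = g p * qim p) {p : ℍ[ℝ]} (hp : p ∈ Ω)
    (hf : DifferentiableAt ℝ f p) (hg : DifferentiableAt ℝ g p) {a b c d : ℝ}
    (hfp : f p = a + b • qim p) (hgp : g p = c + d • qim p) :
    Dl (fun x => f x * g x) p =
      Dl f p * g p + a • Dl g p + b • (Dl g p * qim p) + (4 * b * d) • qim p := by
  have hD : ∀ h, fderiv ℝ (fun x => f x * g x) p h =
      a • fderiv ℝ g p h
        + b • (fderiv ℝ g p h * qim p + (g p * qim h - qim h * g p)) + fderiv ℝ f p h * g p := by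
    intro h
    have hfg : HasFDerivAt (fun x => f x * g x) _ p := hf.hasFDerivAt.mul' hg.hasFDerivAt
    rw [← qim_mul_fderiv hΩ hcomm hp hg h, hfg.fderiv]
    simp [hfp, add_mul, Quaternion.coe_mul_eq_smul]
  simp only [Dl, hD, hgp]
  generalize fderiv ℝ f p = F
  generalize fderiv ℝ g p = G
  generalize F 1 = F₀, F qi = F₁, F qj = F₂, F qk = F₃,
    G 1 = G₀, G qi = G₁, G qj = G₂, G qk = G₃
  ext <;> simp <;> ring

lemma Hyperholo.apply_eq {Ω : Set ℍ[ℝ]} {f : ℍ[ℝ] → ℍ[ℝ]} {u v : ℍ[ℝ] → ℝ}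
    (hf : Hyperholo Ω f u v) {p : ℍ[ℝ]} (hp : p ∈ Ω) :
    f p = (u p : ℍ[ℝ]) + (v p / rr p) • qim p := by
  rw [hf.2.1 p hp, iota, Quaternion.mul_coe_eq_smul, smul_smul, div_eq_mul_inv]

/-- The pointwise quaternionic product of two hyperholomorphic functions is
hyperholomorphic. -/
theorem hyperholo_mul (Ω : Set ℍ[ℝ]) (hΩ : IsOpen Ω)
    (hax : ∀ p ∈ Ω, qim p ≠ 0)
    (f g : ℍ[ℝ] → ℍ[ℝ]) (u v u' v' : ℍ[ℝ] → ℝ)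
    (hf : Hyperholo Ω f u v) (hg : Hyperholo Ω g u' v') :
    Hyperholo Ω (fun p => f p * g p) (fun p => u p * u' p - v p * v' p)
      (fun p => u p * v' p + v p * u' p) := by
  have hcomm : ∀ p ∈ Ω, qim p * g p = g p * qim p := by
    intro p hp
    rw [hg.apply_eq hp, mul_add, add_mul, mul_smul_comm, smul_mul_assoc, Quaternion.coe_commutes]
  refine ⟨fun p hp => (hf.1 p hp).mul (hg.1 p hp), fun p hp => ?_, fun p hp => ?_⟩
  · have hι := iota_mul_self (hax p hp)
    have hmul : ∀ (q : ℍ[ℝ]) (a b c d : ℝ), ((a : ℍ[ℝ]) + q * b) * (c + q * d) =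
        ((a * c : ℝ) : ℍ[ℝ]) + q * ((a * d + b * c : ℝ) : ℍ[ℝ]) + (b * d) • (q * q) := by
      intro q a b c d
      ext <;> simp [-Quaternion.coe_mul, -Quaternion.coe_add] <;> ring
    simp only [hf.2.1 p hp, hg.2.1 p hp, hmul, hι]
    ext <;> simp [-Quaternion.coe_mul, -Quaternion.coe_add, -Quaternion.coe_sub] <;> ring
  · rw [Dl_mul hΩ hcomm hp (hf.1 p hp) (hg.1 p hp) (hf.apply_eq hp) (hg.apply_eq hp),
      hf.2.2 p hp, hg.2.2 p hp, hg.apply_eq hp]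
    ext <;> simp [-Quaternion.coe_mul, -Quaternion.coe_div, -Quaternion.coe_neg] <;> ring
end
end

section
/- Let Ω ⊆ H be an open set disjoint from the real axis and let f = u + ιv be hyperholomorphic on Ω. Let p = t + r·ι(α,β) ∈ Ω with r > 0 and sin β ≠ 0, and define the angular coordinate derivatives ∂_α f(p) := (d/ds)|_{s=α} f(t + r·ι(s,β)) and ∂_β f(p) := (d/ds)|_{s=β} f(t + r·ι(α,s)). Then (ι_α)⁻¹·∂_α f(p) + (ι_β)⁻¹·∂_β f(p) = 2·v(p), where ι_α = ∂ι/∂α(α,β) and ι_β = ∂ι/∂β(α,β) are the (purely imaginary, invertible when sin β ≠ 0) partial derivatives of ι(α,β), and the inverses are quaternionic multiplicative inverses acting by left multiplication. -/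
open Quaternion MeasureTheory

noncomputable section

/-- the partial derivative of ι(α,β) with respect to α -/
def iotaA (α β : ℝ) : ℍ[ℝ] :=
  ⟨0, -(Real.sin α * Real.sin β), Real.cos α * Real.sin β, 0⟩

/-- the partial derivative of ι(α,β) with respect to β -/
def iotaB (α β : ℝ) : ℍ[ℝ] :=
  ⟨0, Real.cos α * Real.cos β, Real.sin α * Real.cos β, -Real.sin β⟩

@[simp] theorem qi_components : qi.re = 0 ∧ qi.imI = 1 ∧ qi.imJ = 0 ∧ qi.imK = 0 :=
  ⟨rfl, rfl, rfl, rfl⟩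

@[simp] theorem qj_components : qj.re = 0 ∧ qj.imI = 0 ∧ qj.imJ = 1 ∧ qj.imK = 0 :=
  ⟨rfl, rfl, rfl, rfl⟩

@[simp] theorem qk_components : qk.re = 0 ∧ qk.imI = 0 ∧ qk.imJ = 0 ∧ qk.imK = 1 :=
  ⟨rfl, rfl, rfl, rfl⟩

@[simp] theorem qim_components (p : ℍ[ℝ]) :
    (qim p).re = 0 ∧ (qim p).imI = p.imI ∧ (qim p).imJ = p.imJ ∧ (qim p).imK = p.imK :=
  ⟨rfl, rfl, rfl, rfl⟩

@[simp] theorem iotaSph_components (α β : ℝ) :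
    (iotaSph α β).re = 0 ∧ (iotaSph α β).imI = Real.cos α * Real.sin β ∧
      (iotaSph α β).imJ = Real.sin α * Real.sin β ∧ (iotaSph α β).imK = Real.cos β :=
  ⟨rfl, rfl, rfl, rfl⟩

@[simp] theorem iotaA_components (α β : ℝ) :
    (iotaA α β).re = 0 ∧ (iotaA α β).imI = -(Real.sin α * Real.sin β) ∧
      (iotaA α β).imJ = Real.cos α * Real.sin β ∧ (iotaA α β).imK = 0 :=
  ⟨rfl, rfl, rfl, rfl⟩

@[simp] theorem iotaB_components (α β : ℝ) :
    (iotaB α β).re = 0 ∧ (iotaB α β).imI = Real.cos α * Real.cos β ∧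
      (iotaB α β).imJ = Real.sin α * Real.cos β ∧ (iotaB α β).imK = -Real.sin β :=
  ⟨rfl, rfl, rfl, rfl⟩

theorem pt_eq_add_smul (t r α β : ℝ) : pt t r α β = (t : ℍ[ℝ]) + r • iotaSph α β := by
  rw [pt, Quaternion.coe_mul_eq_smul]

@[simp] theorem pt_components (t r α β : ℝ) :
    (pt t r α β).re = t ∧ (pt t r α β).imI = r * (Real.cos α * Real.sin β) ∧
      (pt t r α β).imJ = r * (Real.sin α * Real.sin β) ∧
      (pt t r α β).imK = r * Real.cos β := by
  simp [pt_eq_add_smul]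

theorem rr_pt (t r α β : ℝ) (hr : 0 < r) : rr (pt t r α β) = r := by
  have h : (pt t r α β).imI ^ 2 + (pt t r α β).imJ ^ 2 + (pt t r α β).imK ^ 2 = r ^ 2 := by
    simp only [pt_components]
    linear_combination (r ^ 2 * Real.sin β ^ 2) * Real.sin_sq_add_cos_sq α +
      r ^ 2 * Real.sin_sq_add_cos_sq β
  rw [rr, h, Real.sqrt_sq hr.le]

theorem iota_pt (t r α β : ℝ) (hr : 0 < r) : iota (pt t r α β) = iotaSph α β := by
  rw [iota, rr_pt t r α β hr]
  ext <;> simp [hr.ne']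

theorem iotaSph_mul_self (α β : ℝ) : iotaSph α β * iotaSph α β = -1 := by
  ext <;> simp
  · linear_combination -(Real.sin β ^ 2) * Real.sin_sq_add_cos_sq α - Real.sin_sq_add_cos_sq β
  all_goals ring

theorem iotaSph_eq (α β : ℝ) : iotaSph α β =
    (Real.cos α * Real.sin β) • qi + (Real.sin α * Real.sin β) • qj + Real.cos β • qk := by
  ext <;> simp

theorem iotaA_eq (α β : ℝ) : iotaA α β =
    (-Real.sin α * Real.sin β) • qi + (Real.cos α * Real.sin β) • qj := by
  ext <;> simp

theorem iotaB_eq (α β : ℝ) : iotaB α β =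
    (Real.cos α * Real.cos β) • qi + (Real.sin α * Real.cos β) • qj + (-Real.sin β) • qk := by
  ext <;> simp

theorem hasDerivAt_iotaSph_left (α β : ℝ) :
    HasDerivAt (fun s => iotaSph s β) (iotaA α β) α := by
  simp only [iotaSph_eq, iotaA_eq]
  exact ((((Real.hasDerivAt_cos α).mul_const (Real.sin β)).smul_const qi).fun_add
    (((Real.hasDerivAt_sin α).mul_const (Real.sin β)).smul_const qj)).add_const _

theorem hasDerivAt_iotaSph_right (α β : ℝ) :
    HasDerivAt (fun s => iotaSph α s) (iotaB α β) β := by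
  simp only [iotaSph_eq, iotaB_eq]
  exact ((((Real.hasDerivAt_sin β).const_mul (Real.cos α)).smul_const qi).fun_add
    (((Real.hasDerivAt_sin β).const_mul (Real.sin α)).smul_const qj)).fun_add
      ((Real.hasDerivAt_cos β).smul_const qk)

theorem hasDerivAt_pt_left (t r α β : ℝ) :
    HasDerivAt (fun s => pt t r s β) (r • iotaA α β) α := by
  simp only [pt_eq_add_smul]
  exact ((hasDerivAt_iotaSph_left α β).fun_const_smul r).const_add (t : ℍ[ℝ])

theorem hasDerivAt_pt_right (t r α β : ℝ) :
    HasDerivAt (fun s => pt t r α s) (r • iotaB α β) β := by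
  simp only [pt_eq_add_smul]
  exact ((hasDerivAt_iotaSph_right α β).fun_const_smul r).const_add (t : ℍ[ℝ])

theorem hasDerivAt_pt_radius (t r α β : ℝ) :
    HasDerivAt (fun s => pt t s α β) (iotaSph α β) r := by
  simp only [pt_eq_add_smul]
  simpa only [one_smul] using
    ((hasDerivAt_id' r).smul_const (iotaSph α β)).const_add (t : ℍ[ℝ])

theorem coe_eq_smul_one (a : ℝ) : (a : ℍ[ℝ]) = a • (1 : ℍ[ℝ]) := by
  rw [← Quaternion.coe_mul_eq_smul, mul_one]

theorem hasDerivAt_pt_real (t r α β : ℝ) :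
    HasDerivAt (fun s => pt s r α β) 1 t := by
  simp only [pt_eq_add_smul, coe_eq_smul_one]
  simpa only [one_smul] using
    ((hasDerivAt_id' t).smul_const (1 : ℍ[ℝ])).add_const (r • iotaSph α β)

theorem hasDerivAt_quaternion_re {g : ℝ → ℍ[ℝ]} {g' : ℍ[ℝ]} {s : ℝ} (h : HasDerivAt g g' s) :
    HasDerivAt (fun x => (g x).re) g'.re s := by
  have := (hasDerivAt_const s (1 : ℍ[ℝ])).inner ℝ h
  simpa [Quaternion.inner_def] using this

/-- A complex-like function differentiated along a curve with prescribed imaginary unit. -/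
theorem exists_deriv_complexLike {g n : ℝ → ℍ[ℝ]} {a b : ℝ → ℝ} {g' n' : ℍ[ℝ]} {s : ℝ}
    (hg : HasDerivAt g g' s) (hn : HasDerivAt n n' s)
    (hre : ∀ x, (n x).re = 0) (hsq : ∀ x, n x * n x = -1)
    (h : ∀ᶠ x in nhds s, g x = (a x : ℍ[ℝ]) + n x * (b x : ℍ[ℝ])) :
    ∃ a' b' : ℝ, g' = (a' : ℍ[ℝ]) + b' • n s + b s • n' := by
  have ha : a =ᶠ[nhds s] fun x => (g x).re := h.mono fun x hx => by
    simp [hx, Quaternion.mul_coe_eq_smul, hre]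
  have hb : b =ᶠ[nhds s] fun x => -(n x * g x).re := h.mono fun x hx => by
    have hng : n x * g x = a x • n x - (b x : ℍ[ℝ]) := by
      rw [hx, mul_add, ← mul_assoc, hsq, Quaternion.mul_coe_eq_smul, neg_one_mul, sub_eq_add_neg]
    simp only [hng, Quaternion.re_sub, Quaternion.re_smul, hre, Quaternion.re_coe, smul_zero,
      zero_sub, neg_neg]
  have ha' := (hasDerivAt_quaternion_re hg).congr_of_eventuallyEq ha
  have hb' := (hasDerivAt_quaternion_re (hn.mul hg)).neg.congr_of_eventuallyEq hb
  have hgab : g =ᶠ[nhds s] fun x => a x • (1 : ℍ[ℝ]) + b x • n x := h.mono fun x hx => by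
    rw [hx, Quaternion.mul_coe_eq_smul, coe_eq_smul_one]
  have hsum := ((ha'.smul_const (1 : ℍ[ℝ])).fun_add (hb'.fun_smul hn)).congr_of_eventuallyEq hgab
  refine ⟨g'.re, -(n' * g s + n s * g').re, (hg.unique hsum).trans ?_⟩
  rw [coe_eq_smul_one, add_comm (b s • n'), ← add_assoc]

theorem iotaA_inv (α β : ℝ) : (iotaA α β)⁻¹ = -((Real.sin β ^ 2)⁻¹ • iotaA α β) := by
  have h : Quaternion.normSq (iotaA α β) = Real.sin β ^ 2 := by
    simp only [Quaternion.normSq_def', iotaA_components]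
    linear_combination Real.sin β ^ 2 * Real.sin_sq_add_cos_sq α
  rw [Quaternion.inv_def, h, ← smul_neg]
  congr 1
  ext <;> simp

theorem iotaB_inv (α β : ℝ) : (iotaB α β)⁻¹ = -iotaB α β := by
  have h : Quaternion.normSq (iotaB α β) = 1 := by
    simp only [Quaternion.normSq_def', iotaB_components]
    linear_combination Real.cos β ^ 2 * Real.sin_sq_add_cos_sq α + Real.sin_sq_add_cos_sq β
  rw [Quaternion.inv_def, h, inv_one, one_smul]
  ext <;> simp

theorem iotaA_mul_iotaSph (α β : ℝ) :
    iotaA α β * iotaSph α β = Real.sin β • iotaB α β := by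
  ext <;> simp
  · ring
  · ring
  · ring
  · linear_combination -(Real.sin β ^ 2) * Real.sin_sq_add_cos_sq α

theorem iotaB_mul_iotaSph (α β : ℝ) (hs : Real.sin β ≠ 0) :
    iotaB α β * iotaSph α β = -((Real.sin β)⁻¹ • iotaA α β) := by
  have h := Real.sin_sq_add_cos_sq β
  ext <;> simp
  · linear_combination -Real.cos β * Real.sin β * Real.sin_sq_add_cos_sq α
  · field_simp
    linear_combination Real.sin α * h
  · field_simp
    linear_combination -Real.cos α * h
  · ring

theorem iotaA_mul_self (α β : ℝ) :
    iotaA α β * iotaA α β = (-Real.sin β ^ 2) • (1 : ℍ[ℝ]) := by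
  ext <;> simp
  · linear_combination -(Real.sin β ^ 2) * Real.sin_sq_add_cos_sq α
  all_goals ring

theorem iotaB_mul_self (α β : ℝ) : iotaB α β * iotaB α β = -1 := by
  ext <;> simp
  · linear_combination -(Real.cos β ^ 2) * Real.sin_sq_add_cos_sq α - Real.sin_sq_add_cos_sq β
  all_goals ring

/-- `ι_α` and `ι_β` are linearly independent of `1` and `ι`. -/
theorem tangential_coeff_eq_zero {α β a b x y c : ℝ} (hs : Real.sin β ≠ 0)
    (h : (a : ℍ[ℝ]) + b • iotaSph α β + x • iotaA α β + y • iotaB α β = (c : ℍ[ℝ])) :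
    x = 0 ∧ y = 0 := by
  have hα := Real.sin_sq_add_cos_sq α
  have hβ := Real.sin_sq_add_cos_sq β
  have hi := congrArg (fun q : ℍ[ℝ] => q.imI) h
  have hj := congrArg (fun q : ℍ[ℝ] => q.imJ) h
  have hk := congrArg (fun q : ℍ[ℝ] => q.imK) h
  simp at hi hj hk
  constructor
  · apply (mul_eq_zero.mp (_ : Real.sin β * x = 0)).resolve_left hs
    linear_combination Real.cos α * hj - Real.sin α * hi - Real.sin β * x * hα
  · linear_combination Real.cos α * Real.cos β * hi + Real.sin α * Real.cos β * hj
      - Real.sin β * hk - (b * Real.sin β * Real.cos β + y * Real.cos β ^ 2) * hα - y * hβ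

/-- The imaginary part of the Fueter operator in the orthogonal frame `ι`, `ι_α`, `ι_β`. -/
theorem sum_mul_map_eq_spherical (L : ℍ[ℝ] →L[ℝ] ℍ[ℝ]) (α β : ℝ) (hs : Real.sin β ≠ 0) :
    qi * L qi + qj * L qj + qk * L qk =
      iotaSph α β * L (iotaSph α β) + (Real.sin β ^ 2)⁻¹ • (iotaA α β * L (iotaA α β))
        + iotaB α β * L (iotaB α β) := by
  have hα := Real.sin_sq_add_cos_sq α
  have hβ := Real.sin_sq_add_cos_sq β
  simp only [iotaSph_eq, iotaA_eq, iotaB_eq, map_add, map_smul, add_mul, mul_add, smul_mul_assoc,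
    mul_smul_comm, smul_add, smul_smul]
  match_scalars
  all_goals field_simp
  all_goals grind


/-- For a hyperholomorphic function, the angular part of the Fueter operator equals 2v. -/
theorem hyperholo_angular (Ω : Set ℍ[ℝ]) (hΩ : IsOpen Ω)
    (hax : ∀ p ∈ Ω, qim p ≠ 0)
    (f : ℍ[ℝ] → ℍ[ℝ]) (u v : ℍ[ℝ] → ℝ)
    (hf : Hyperholo Ω f u v) :
    ∀ t r α β : ℝ, 0 < r → Real.sin β ≠ 0 → pt t r α β ∈ Ω →
      (iotaA α β)⁻¹ * deriv (fun s => f (pt t r s β)) α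
        + (iotaB α β)⁻¹ * deriv (fun s => f (pt t r α s)) β
        = ((2 * v (pt t r α β) : ℝ) : ℍ[ℝ]) := by
  intro t r α β hr hs hp
  obtain ⟨hdiff, hfuv, hD⟩ := hf
  have key : ∀ {c n : ℝ → ℍ[ℝ]} {c' n' : ℍ[ℝ]} {s : ℝ}, HasDerivAt c c' s → HasDerivAt n n' s →
      (∀ x, (n x).re = 0) → (∀ x, n x * n x = -1) → c s = pt t r α β →
      (∀ᶠ x in nhds s, iota (c x) = n x) →
      HasDerivAt (fun x => f (c x)) (fderiv ℝ f (pt t r α β) c') s ∧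
      ∃ a b : ℝ, fderiv ℝ f (pt t r α β) c' = (a : ℍ[ℝ]) + b • n s + v (pt t r α β) • n' := by
    intro c n c' n' s hc hn hre hsq hcs hι
    have hfc : HasDerivAt (fun x => f (c x)) (fderiv ℝ f (pt t r α β) c') s :=
      HasFDerivAt.comp_hasDerivAt s (by rw [hcs]; exact (hdiff _ hp).hasFDerivAt) hc
    have hev : ∀ᶠ x in nhds s, f (c x) = (u (c x) : ℍ[ℝ]) + n x * (v (c x) : ℍ[ℝ]) := by
      filter_upwards [hι, hc.continuousAt (hΩ.mem_nhds (hcs ▸ hp))] with x hx hxΩ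
      rw [hfuv _ hxΩ, hx]
    refine ⟨hfc, ?_⟩
    simpa only [hcs] using
      exists_deriv_complexLike (b := fun x => v (c x)) hfc hn hre hsq hev
  have hsph := hasDerivAt_const (𝕜 := ℝ) (F := ℍ[ℝ])
  obtain ⟨-, a₀, b₀, h₀⟩ := key (hasDerivAt_pt_real t r α β) (hsph t (iotaSph α β))
    (fun _ => rfl) (fun _ => iotaSph_mul_self α β) rfl
    (Filter.Eventually.of_forall fun _ => iota_pt _ _ _ _ hr)
  obtain ⟨-, a₁, b₁, h₁⟩ := key (hasDerivAt_pt_radius t r α β) (hsph r (iotaSph α β))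
    (fun _ => rfl) (fun _ => iotaSph_mul_self α β) rfl
    ((eventually_gt_nhds hr).mono fun _ hx => iota_pt _ _ _ _ hx)
  obtain ⟨hA, a₂, b₂, h₂⟩ := key (hasDerivAt_pt_left t r α β) (hasDerivAt_iotaSph_left α β)
    (fun _ => rfl) (fun _ => iotaSph_mul_self _ β) rfl
    (Filter.Eventually.of_forall fun _ => iota_pt _ _ _ _ hr)
  obtain ⟨hB, a₃, b₃, h₃⟩ := key (hasDerivAt_pt_right t r α β) (hasDerivAt_iotaSph_right α β)
    (fun _ => rfl) (fun _ => iotaSph_mul_self α _) rfl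
    (Filter.Eventually.of_forall fun _ => iota_pt _ _ _ _ hr)
  rw [hA.deriv, hB.deriv, h₂, h₃, iotaA_inv, iotaB_inv]
  have hDp := hD _ hp
  set w := v (pt t r α β)
  have hA' : (Real.sin β ^ 2)⁻¹ • (iotaA α β * ((a₂ : ℍ[ℝ]) + b₂ • iotaSph α β + w • iotaA α β)) =
      ((-w : ℝ) : ℍ[ℝ]) + (a₂ / Real.sin β ^ 2) • iotaA α β + (b₂ / Real.sin β) • iotaB α β := by
    simp only [mul_add, mul_smul_comm, iotaA_mul_iotaSph, iotaA_mul_self, smul_add, smul_smul,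
      coe_eq_smul_one, mul_one]
    match_scalars <;> field_simp
  have hB' : iotaB α β * ((a₃ : ℍ[ℝ]) + b₃ • iotaSph α β + w • iotaB α β) =
      ((-w : ℝ) : ℍ[ℝ]) + (-b₃ / Real.sin β) • iotaA α β + a₃ • iotaB α β := by
    simp only [mul_add, mul_smul_comm, iotaB_mul_iotaSph α β hs, iotaB_mul_self,
      coe_eq_smul_one, mul_one]
    match_scalars <;> field_simp
  have hD' : ((a₀ - b₁ + -2 * w / r : ℝ) : ℍ[ℝ]) + (b₀ + a₁) • iotaSph α β
      + ((a₂ / Real.sin β ^ 2 + -b₃ / Real.sin β) / r) • iotaA α β + ((b₂ / Real.sin β + a₃) / r) • iotaB α β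
      = ((-2 * w / r : ℝ) : ℍ[ℝ]) := by
    rw [rr_pt t r α β hr, Dl, add_assoc, add_assoc, ← add_assoc (qi * _),
      sum_mul_map_eq_spherical _ α β hs, h₀, h₁] at hDp
    have hLA : fderiv ℝ f (pt t r α β) (iotaA α β) =
        r⁻¹ • ((a₂ : ℍ[ℝ]) + b₂ • iotaSph α β + w • iotaA α β) := by
      rw [← h₂, map_smul, inv_smul_smul₀ hr.ne']
    have hLB : fderiv ℝ f (pt t r α β) (iotaB α β) =
        r⁻¹ • ((a₃ : ℍ[ℝ]) + b₃ • iotaSph α β + w • iotaB α β) := by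
      rw [← h₃, map_smul, inv_smul_smul₀ hr.ne']
    rw [hLA, hLB, mul_smul_comm, mul_smul_comm, smul_comm, hA', hB'] at hDp
    rw [← hDp]
    simp only [mul_add, mul_smul_comm, iotaSph_mul_self, smul_zero, mul_zero,
      coe_eq_smul_one, mul_one]
    match_scalars <;> ring
  obtain ⟨hx, hy⟩ := tangential_coeff_eq_zero hs hD'
  rw [neg_mul, smul_mul_assoc, neg_mul, hA', hB']
  have hx' := (div_eq_zero_iff.mp hx).resolve_right hr.ne'
  have hy' := (div_eq_zero_iff.mp hy).resolve_right hr.ne'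
  simp only [coe_eq_smul_one]
  match_scalars
  · ring
  · linear_combination -hx'
  · linear_combination -hy'
end
end
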